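/- (Korn inequality on a slab with bottom Dirichlet condition) Let Ω = ℝ^{d-1} × (−b, 0) with lower boundary Σ_b. For every u ∈ H¹(Ω; ℝ^d) with u = 0 on Σ_b, one has ‖u‖_{H¹(Ω)} ≲ ‖𝔻u‖_{L²(Ω)}, where 𝔻u = ∇u + (∇u)ᵀ is the symmetric gradient. -/

import Mathlib

open MeasureTheory Set

noncomputable section

abbrev slabM (n : ℕ) (B : ℝ) : Measure (ℝ × (Fin n → ℝ)) :=
  (volume.restrict (Ioo (-B) 0)).prod volume

lemma korn_deriv_line {P : Type*} [NormedAddCommGroup P] [NormedSpace ℝ P]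
    {g : P → ℝ} (hg : ContDiff ℝ 1 g) (p a : P) (h : ℝ) :
    HasDerivAt (fun s : ℝ => g (p + s • a)) (fderiv ℝ g (p + h • a) a) h := by
  have h1 : HasFDerivAt g (fderiv ℝ g (p + h • a)) (p + h • a) :=
    ((hg.differentiable one_ne_zero) _).hasFDerivAt
  have h2 : HasDerivAt (fun s : ℝ => p + s • a) a h := by
    simpa using ((hasDerivAt_id h).smul_const a).const_add p
  exact h1.comp_hasDerivAt h h2

lemma korn_cont_dir {P : Type*} [NormedAddCommGroup P] [NormedSpace ℝ P]
    {g : P → ℝ} (hg : ContDiff ℝ 1 g) (a : P) : Continuous (fun p => fderiv ℝ g p a) :=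
  (hg.continuous_fderiv one_ne_zero).clm_apply continuous_const

lemma korn_D {P : Type*} [NormedAddCommGroup P] [NormedSpace ℝ P] [FiniteDimensional ℝ P]
    [MeasurableSpace P] [BorelSpace P]
    (ν : Measure P) [IsFiniteMeasureOnCompacts ν] {f g : P → ℝ} (hf : Continuous f)
    (hg : ContDiff ℝ 1 g) (a : P) (hs : HasCompactSupport f ∨ HasCompactSupport g) :
    HasDerivAt (fun h : ℝ => ∫ p, f p * g (p + h • a) ∂ν) (∫ p, f p * fderiv ℝ g p a ∂ν) 0 := by
  obtain ⟨K, hK, hK0⟩ : ∃ K : Set P, IsCompact K ∧ ∀ p ∉ K, ∀ h ∈ Icc (-1 : ℝ) 1,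
      f p * fderiv ℝ g (p + h • a) a = 0 := by
    rcases hs with hs | hs
    · refine ⟨tsupport f, hs, fun p hp h _ => ?_⟩
      rw [image_eq_zero_of_notMem_tsupport hp, zero_mul]
    · refine ⟨(fun q : P × ℝ => q.1 - q.2 • a) '' (tsupport g ×ˢ Icc (-1 : ℝ) 1),
        (hs.isCompact.prod isCompact_Icc).image (by fun_prop), fun p hp h hh => ?_⟩
      have : p + h • a ∉ tsupport g := by
        intro hm
        exact hp ⟨(p + h • a, h), ⟨hm, hh⟩, by simp⟩
      have h2 : p + h • a ∉ tsupport (fderiv ℝ g) := fun hm =>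
        this (tsupport_fderiv_subset ℝ hm)
      rw [image_eq_zero_of_notMem_tsupport h2]; simp
  have hgc := korn_cont_dir hg a
  obtain ⟨M, hM⟩ := (hK.prod (isCompact_Icc (a := (-1 : ℝ)) (b := 1))).exists_bound_of_continuousOn
    (f := fun q : P × ℝ => f q.1 * fderiv ℝ g (q.1 + q.2 • a) a)
    (by
      apply Continuous.continuousOn
      exact (hf.comp continuous_fst).mul (hgc.comp (by fun_prop)))
  have key := hasDerivAt_integral_of_dominated_loc_of_deriv_le (μ := ν) (𝕜 := ℝ)
    (F := fun h p => f p * g (p + h • a)) (x₀ := 0) (s := Icc (-1 : ℝ) 1)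
    (F' := fun h p => f p * fderiv ℝ g (p + h • a) a) (bound := K.indicator (fun _ => M))
    (Icc_mem_nhds (by norm_num) (by norm_num))
    (Filter.Eventually.of_forall fun h => by
      have : Continuous fun p => f p * g (p + h • a) :=
        hf.mul (hg.continuous.comp (by fun_prop))
      exact this.aestronglyMeasurable)
    (by
      have : Continuous fun p => f p * g (p + (0 : ℝ) • a) :=
        hf.mul (hg.continuous.comp (by fun_prop))
      apply this.integrable_of_hasCompactSupport
      simp only [zero_smul, add_zero]
      rcases hs with hs | hs
      · exact hs.mul_right
      · exact hs.mul_left)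
    (by
      have : Continuous fun p => f p * fderiv ℝ g (p + (0 : ℝ) • a) a :=
        hf.mul (hgc.comp (by fun_prop))
      exact this.aestronglyMeasurable)
    (Filter.Eventually.of_forall fun p h hh => by
      by_cases hp : p ∈ K
      · rw [indicator_of_mem hp]
        exact hM (p, h) ⟨hp, hh⟩
      · rw [hK0 p hp h hh]; simp [hp])
    (by
      rw [integrable_indicator_iff hK.measurableSet]
      exact integrableOn_const hK.measure_lt_top.ne)
    (Filter.Eventually.of_forall fun p h hh => (korn_deriv_line hg p a h).const_mul (f p))
  simpa using key.2

lemma korn_translate {n : ℕ} (B : ℝ) (a : Fin n → ℝ) (f : ℝ × (Fin n → ℝ) → ℝ) :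
    ∫ p, f (p + ((0 : ℝ), a)) ∂(slabM n B) = ∫ p, f p ∂(slabM n B) := by
  have h : MeasurePreserving (Prod.map id (fun x : Fin n → ℝ => x + a)) (slabM n B) (slabM n B) :=
    (MeasurePreserving.id _).prod (measurePreserving_add_right volume a)
  have h2 : MeasurableEmbedding (Prod.map id (fun x : Fin n → ℝ => x + a) :
      ℝ × (Fin n → ℝ) → ℝ × (Fin n → ℝ)) :=
    MeasurableEmbedding.id.prodMap (measurableEmbedding_addRight a)
  rw [← h.integral_comp h2 f]
  congr 1; ext p
  congr 1; ext <;> simp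

/-- horizontal Stokes -/
lemma korn_stokes_h {n : ℕ} (B : ℝ) (a : Fin n → ℝ) {F : ℝ × (Fin n → ℝ) → ℝ}
    (hF : ContDiff ℝ 1 F) (hs : HasCompactSupport F) :
    ∫ p, fderiv ℝ F p ((0 : ℝ), a) ∂(slabM n B) = 0 := by
  have h := korn_D (slabM n B) (f := fun _ => 1) continuous_const hF ((0 : ℝ), a) (Or.inr hs)
  have h2 : (fun h : ℝ => ∫ p, (1 : ℝ) * F (p + h • ((0 : ℝ), a)) ∂(slabM n B))
      = fun _ => ∫ p, F p ∂(slabM n B) := by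
    ext h
    simp only [one_mul, Prod.smul_mk, smul_zero]
    exact korn_translate B (h • a) F
  rw [h2] at h
  have := h.unique (hasDerivAt_const _ _)
  simpa using this

/-- vertical Stokes -/
lemma korn_stokes_v {n : ℕ} {B : ℝ} (hB : 0 < B) {F : ℝ × (Fin n → ℝ) → ℝ}
    (hF : ContDiff ℝ 1 F) (hs : HasCompactSupport F) (h0 : ∀ x, F (-B, x) = 0) :
    ∫ p, fderiv ℝ F p ((1 : ℝ), 0) ∂(slabM n B) = ∫ x, F (0, x) := by
  have hi : Integrable (fun p => fderiv ℝ F p ((1 : ℝ), 0)) (slabM n B) :=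
    (korn_cont_dir hF _).integrable_of_hasCompactSupport
      (hs.fderiv_apply (𝕜 := ℝ) _)
  rw [integral_prod_symm _ hi]
  congr 1; ext x
  rw [← integral_Ioc_eq_integral_Ioo, ← intervalIntegral.integral_of_le (by linarith)]
  rw [intervalIntegral.integral_eq_sub_of_hasDerivAt (f := fun y => F (y, x)), h0, sub_zero]
  · intro y _
    have := korn_deriv_line hF (0, x) ((1 : ℝ), 0) y
    simpa using this
  · apply Continuous.intervalIntegrable
    exact (korn_cont_dir hF _).comp (by fun_prop)

/-- the bilinear identity, compact support -/
lemma korn_bilin {n : ℕ} (B : ℝ) (a : Fin n → ℝ) (e : ℝ × (Fin n → ℝ)) (ε : ℝ)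
    {v w : ℝ × (Fin n → ℝ) → ℝ}
    (hv : ContDiff ℝ 1 v) (hw : ContDiff ℝ 1 w) (hs : HasCompactSupport v)
    (hst : ∀ h : ℝ, ∫ p, fderiv ℝ (fun p => v p * w (p + h • ((0 : ℝ), a))) p e ∂(slabM n B)
      = ε * ∫ x, v (0, x) * w ((0, x) + h • ((0 : ℝ), a))) :
    (∫ p, fderiv ℝ v p e * fderiv ℝ w p (0, a) - fderiv ℝ v p (0, a) * fderiv ℝ w p e ∂(slabM n B))
      = ε * ∫ x, v (0, x) * fderiv ℝ w (0, x) (0, a) := by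
  have hve := korn_cont_dir hv e
  have hwe := korn_cont_dir hw e
  have hva := korn_cont_dir hv (0, a)
  have hwa := korn_cont_dir hw (0, a)
  have hvs : HasCompactSupport (fun p => fderiv ℝ v p e) := hs.fderiv_apply (𝕜 := ℝ) _
  have hvas : HasCompactSupport (fun p => fderiv ℝ v p (0, a)) := hs.fderiv_apply (𝕜 := ℝ) _
  have d1 := korn_D (slabM n B) hve hw ((0 : ℝ), a) (Or.inl hvs)
  have d2 := korn_D (slabM n B) hwe hv (-((0 : ℝ), a)) (Or.inr hs)
  have d3 : HasDerivAt (fun h : ℝ => ∫ x, v (0, x) * w ((0, x) + h • ((0 : ℝ), a)))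
      (∫ x, v (0, x) * fderiv ℝ w (0, x) (0, a)) 0 := by
    have hv0 : Continuous fun x : Fin n → ℝ => v (0, x) := hv.continuous.comp (by fun_prop)
    have hw0 : ContDiff ℝ 1 fun x : Fin n → ℝ => w (0, x) := hw.comp (by fun_prop)
    have hs0 : HasCompactSupport fun x : Fin n → ℝ => v (0, x) :=
      HasCompactSupport.intro (hs.isCompact.image continuous_snd) fun x hx => by
        by_contra hne
        exact hx ⟨(0, x), subset_tsupport _ hne, rfl⟩
    have := korn_D (volume : Measure (Fin n → ℝ)) hv0 hw0 a (Or.inl hs0)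
    convert this using 1
    · ext h; simp
    · congr 1; ext x
      have h1 := korn_deriv_line hw (0, x) ((0 : ℝ), a) 0
      have h2 := korn_deriv_line hw0 x a 0
      simp only [Prod.smul_mk, smul_zero, Prod.mk_add_mk, add_zero, zero_smul] at h1 h2
      rw [h1.unique h2]
  have heq : (fun h : ℝ => ε * ∫ x, v (0, x) * w ((0, x) + h • ((0 : ℝ), a)))
      = fun h : ℝ => (∫ p, fderiv ℝ v p e * w (p + h • ((0 : ℝ), a)) ∂(slabM n B))
        + ∫ p, fderiv ℝ w p e * v (p + h • (-((0 : ℝ), a))) ∂(slabM n B) := by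
    ext h
    rw [← hst h]
    rw [← korn_translate B (h • a) (fun p => fderiv ℝ w p e * v (p + h • (-((0 : ℝ), a))))]
    rw [← integral_add]
    · congr 1; ext p
      have hd1 : HasFDerivAt v (fderiv ℝ v p) p := ((hv.differentiable one_ne_zero) _).hasFDerivAt
      have hd2 : HasFDerivAt (fun p => w (p + h • ((0 : ℝ), a)))
          (fderiv ℝ w (p + h • ((0 : ℝ), a))) p := by
        have h1 : HasFDerivAt w (fderiv ℝ w (p + h • ((0 : ℝ), a))) (p + h • ((0 : ℝ), a)) :=
          ((hw.differentiable one_ne_zero) _).hasFDerivAt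
        have h2 := h1.comp p ((hasFDerivAt_id p).add_const (h • ((0 : ℝ), a)))
        simpa [Function.comp_def] using h2
      have hm : fderiv ℝ (fun p => v p * w (p + h • ((0 : ℝ), a))) p = _ := (hd1.mul hd2).fderiv
      rw [hm]
      have : p + (0, h • a) + h • -((0 : ℝ), a) = p := by ext <;> simp
      simp only [this]
      simp
      ring
    · apply Continuous.integrable_of_hasCompactSupport
      · exact hve.mul (hw.continuous.comp (by fun_prop))
      · exact hvs.mul_right
    · have : ∀ p : ℝ × (Fin n → ℝ), p + (0, h • a) + h • -((0 : ℝ), a) = p := by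
        intro p; ext <;> simp
      simp only [this]
      apply Continuous.integrable_of_hasCompactSupport
      · exact (hwe.comp (by fun_prop)).mul hv.continuous
      · exact hs.mul_left
  have d4 := d3.const_mul ε
  rw [heq] at d4
  rw [d4.unique (d1.add d2), ← integral_add]
  · congr 1; ext p
    simp only [map_neg]; ring
  · apply Continuous.integrable_of_hasCompactSupport
    · exact hve.mul hwa
    · exact hvs.mul_right
  · apply Continuous.integrable_of_hasCompactSupport
    · simp only [map_neg]
      exact hwe.mul hva.neg
    · simp only [map_neg]
      exact (hvas.neg).mul_left

structure KornCut (n : ℕ) (θ : ℕ → ℝ × (Fin n → ℝ) → ℝ) (M : ℝ) : Prop where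
  smooth : ∀ k, ContDiff ℝ 1 (θ k)
  supp : ∀ k, HasCompactSupport (θ k)
  bdd : ∀ k p, |θ k p| ≤ 1
  lim : ∀ p, Filter.Tendsto (fun k => θ k p) Filter.atTop (nhds 1)
  nonneg : 0 ≤ M
  dbdd : ∀ k p, ‖fderiv ℝ (θ k) p‖ ≤ M * (1 / ((k : ℝ) + 1))

lemma korn_cut_exists (n : ℕ) : ∃ θ M, KornCut n θ M := by
  let χ : ContDiffBump (0 : ℝ × (Fin n → ℝ)) := ⟨1, 2, by norm_num, by norm_num⟩
  have hχ : ContDiff ℝ 1 (χ : ℝ × (Fin n → ℝ) → ℝ) := χ.contDiff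
  obtain ⟨M, hM⟩ := (hχ.continuous_fderiv one_ne_zero).bounded_above_of_compact_support
    (χ.hasCompactSupport.fderiv (𝕜 := ℝ))
  have hpos : ∀ k : ℕ, (0 : ℝ) < 1 / ((k : ℝ) + 1) := fun k => Nat.one_div_pos_of_nat
  refine ⟨fun k p => χ ((1 / ((k : ℝ) + 1)) • p), M, ?_, ?_, ?_, ?_, ?_, ?_⟩
  · intro k; exact hχ.comp (by fun_prop)
  · intro k
    exact χ.hasCompactSupport.comp_smul (hpos k).ne'
  · intro k p
    rw [abs_of_nonneg χ.nonneg]; exact χ.le_one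
  · intro p
    have h1 : Filter.Tendsto (fun k : ℕ => (1 / ((k : ℝ) + 1)) • p) Filter.atTop
        (nhds ((0 : ℝ) • p)) := tendsto_one_div_add_atTop_nhds_zero_nat.smul_const p
    rw [zero_smul] at h1
    have h2 := (hχ.continuous.tendsto 0).comp h1
    rwa [χ.one_of_mem_closedBall (by simp; exact zero_le_one)] at h2
  · exact (norm_nonneg _).trans (hM 0)
  · intro k p
    have h1 : HasFDerivAt χ (fderiv ℝ χ ((1 / ((k : ℝ) + 1)) • p)) ((1 / ((k : ℝ) + 1)) • p) :=
      ((hχ.differentiable one_ne_zero) _).hasFDerivAt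
    have h2 := h1.comp p ((hasFDerivAt_id p).const_smul (1 / ((k : ℝ) + 1)))
    have h3 : fderiv ℝ (fun p => χ ((1 / ((k : ℝ) + 1)) • p)) p = _ := h2.fderiv
    rw [h3]
    rw [ContinuousLinearMap.comp_smul, norm_smul, Real.norm_of_nonneg (hpos k).le,
      ContinuousLinearMap.comp_id, mul_comm]
    exact mul_le_mul_of_nonneg_right (hM _) (hpos k).le

structure KornL2 {n : ℕ} (B : ℝ) (v : ℝ × (Fin n → ℝ) → ℝ) : Prop where
  smooth : ContDiff ℝ 1 v
  zeroth : MemLp v 2 (slabM n B)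
  first : ∀ e, MemLp (fun p => fderiv ℝ v p e) 2 (slabM n B)

lemma korn_int_mul {n : ℕ} {B : ℝ} {f g : ℝ × (Fin n → ℝ) → ℝ} (hf : MemLp f 2 (slabM n B))
    (hg : MemLp g 2 (slabM n B)) : Integrable (fun p => f p * g p) (slabM n B) :=
  hf.integrable_mul hg

lemma korn_limit {n : ℕ} {B : ℝ} {θ : ℕ → ℝ × (Fin n → ℝ) → ℝ} {M : ℝ} (hθ : KornCut n θ M)
    {v w : ℝ × (Fin n → ℝ) → ℝ} (hv : KornL2 B v) (hw : KornL2 B w) (e e' : ℝ × (Fin n → ℝ)) :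
    Filter.Tendsto (fun k => ∫ p, fderiv ℝ (fun p => θ k p * v p) p e * fderiv ℝ w p e'
        - fderiv ℝ (fun p => θ k p * v p) p e' * fderiv ℝ w p e ∂(slabM n B)) Filter.atTop
      (nhds (∫ p, fderiv ℝ v p e * fderiv ℝ w p e'
        - fderiv ℝ v p e' * fderiv ℝ w p e ∂(slabM n B))) := by
  have hfd : ∀ k p e, fderiv ℝ (fun p => θ k p * v p) p e
      = θ k p * fderiv ℝ v p e + fderiv ℝ (θ k) p e * v p := by
    intro k p e
    have h1 : HasFDerivAt (θ k) (fderiv ℝ (θ k) p) p :=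
      (((hθ.smooth k).differentiable one_ne_zero) _).hasFDerivAt
    have h2 : HasFDerivAt v (fderiv ℝ v p) p :=
      ((hv.smooth.differentiable one_ne_zero) _).hasFDerivAt
    have h3 : fderiv ℝ (fun p => θ k p * v p) p = _ := (h1.mul h2).fderiv
    rw [h3]; simp; ring
  have hk1 : ∀ k : ℕ, 1 / ((k : ℝ) + 1) ≤ 1 := fun k => by
    rw [div_le_one (by positivity)]; linarith [Nat.cast_nonneg (α := ℝ) k]
  have hM := hθ.nonneg
  have hdb0 : ∀ k p e, |fderiv ℝ (θ k) p e| ≤ M * (1 / ((k : ℝ) + 1)) * ‖e‖ := by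
    intro k p e
    rw [← Real.norm_eq_abs]
    exact ((fderiv ℝ (θ k) p).le_opNorm e).trans
      (mul_le_mul_of_nonneg_right (hθ.dbdd k p) (norm_nonneg _))
  have hdb : ∀ k p e, |fderiv ℝ (θ k) p e| ≤ M * ‖e‖ := by
    intro k p e
    refine (hdb0 k p e).trans (mul_le_mul_of_nonneg_right ?_ (norm_nonneg _))
    exact mul_le_of_le_one_right hM (hk1 k)
  have hdl : ∀ p e, Filter.Tendsto (fun k => fderiv ℝ (θ k) p e) Filter.atTop (nhds 0) := by
    intro p e
    refine squeeze_zero_norm (fun k => hdb0 k p e) ?_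
    have := ((tendsto_one_div_add_atTop_nhds_zero_nat (𝕜 := ℝ)).const_mul M).mul_const ‖e‖
    simpa using this
  simp only [hfd]
  refine tendsto_integral_of_dominated_convergence
    (fun p => |fderiv ℝ v p e * fderiv ℝ w p e'| + M * ‖e‖ * |v p * fderiv ℝ w p e'|
      + (|fderiv ℝ v p e' * fderiv ℝ w p e| + M * ‖e'‖ * |v p * fderiv ℝ w p e|)) ?_ ?_ ?_ ?_
  · intro k
    have c1 := (hθ.smooth k).continuous
    have c2 := hv.smooth.continuous
    have c3 := fun e => korn_cont_dir (hθ.smooth k) e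
    have c4 := fun e => korn_cont_dir hv.smooth e
    have c5 := fun e => korn_cont_dir hw.smooth e
    apply Continuous.aestronglyMeasurable
    exact (((c1.mul (c4 e)).add ((c3 e).mul c2)).mul (c5 e')).sub
      (((c1.mul (c4 e')).add ((c3 e').mul c2)).mul (c5 e))
  · exact (((korn_int_mul (hv.first e) (hw.first e')).abs).add
      (((korn_int_mul hv.zeroth (hw.first e')).abs).const_mul _)).add
      (((korn_int_mul (hv.first e') (hw.first e)).abs).add
      (((korn_int_mul hv.zeroth (hw.first e)).abs).const_mul _))
  · intro k
    refine Filter.Eventually.of_forall fun p => ?_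
    rw [Real.norm_eq_abs]
    have aux : ∀ t q x y z N : ℝ, |t| ≤ 1 → |q| ≤ N → |(t * x + q * y) * z| ≤ |x * z| + N * |y * z| := by
      intro t q x y z N ht hq
      rw [add_mul, mul_assoc, mul_assoc]
      refine (abs_add_le _ _).trans ?_
      rw [abs_mul t, abs_mul q]
      refine add_le_add (mul_le_of_le_one_left (abs_nonneg _) ht)
        (mul_le_mul_of_nonneg_right hq (abs_nonneg _))
    exact (abs_sub _ _).trans (add_le_add (aux _ _ _ _ _ _ (hθ.bdd k p) (hdb k p e))
      (aux _ _ _ _ _ _ (hθ.bdd k p) (hdb k p e')))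
  · refine Filter.Eventually.of_forall fun p => ?_
    have l := hθ.lim p
    have := ((((l.mul_const (fderiv ℝ v p e)).add ((hdl p e).mul_const (v p))).mul_const
      (fderiv ℝ w p e')).sub (((l.mul_const (fderiv ℝ v p e')).add
      ((hdl p e').mul_const (v p))).mul_const (fderiv ℝ w p e)))
    simpa using this

lemma korn_H {n : ℕ} {B : ℝ} {v w : ℝ × (Fin n → ℝ) → ℝ} (hv : KornL2 B v) (hw : KornL2 B w)
    (a a' : Fin n → ℝ) :
    ∫ p, fderiv ℝ v p (0, a') * fderiv ℝ w p (0, a)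
        - fderiv ℝ v p (0, a) * fderiv ℝ w p (0, a') ∂(slabM n B) = 0 := by
  obtain ⟨θ, M, hθ⟩ := korn_cut_exists n
  refine tendsto_nhds_unique (korn_limit hθ hv hw (0, a') (0, a)) ?_
  have : ∀ k, ∫ p, fderiv ℝ (fun p => θ k p * v p) p (0, a') * fderiv ℝ w p (0, a)
        - fderiv ℝ (fun p => θ k p * v p) p (0, a) * fderiv ℝ w p (0, a') ∂(slabM n B) = 0 := by
    intro k
    have hθv := (hθ.smooth k).mul hv.smooth
    have hs : HasCompactSupport (fun p => θ k p * v p) := (hθ.supp k).mul_right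
    rw [korn_bilin B a (0, a') 0 hθv hw.smooth hs, zero_mul]
    intro h
    rw [zero_mul]
    apply korn_stokes_h
    · exact hθv.mul (hw.smooth.comp (by fun_prop))
    · exact hs.mul_right
  simp only [this]
  exact tendsto_const_nhds

lemma korn_V {n : ℕ} {B : ℝ} (hB : 0 < B) {θ : ℕ → ℝ × (Fin n → ℝ) → ℝ} {M : ℝ}
    (hθ : KornCut n θ M) {v w : ℝ × (Fin n → ℝ) → ℝ} (hv : KornL2 B v) (hw : KornL2 B w)
    (h0 : (∀ x, v (-B, x) = 0) ∨ (∀ x, w (-B, x) = 0)) (a : Fin n → ℝ) :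
    Filter.Tendsto (fun k => ∫ x, θ k (0, x) * v (0, x) * fderiv ℝ w (0, x) (0, a)) Filter.atTop
    (nhds (∫ p, fderiv ℝ v p (1, 0) * fderiv ℝ w p (0, a)
        - fderiv ℝ v p (0, a) * fderiv ℝ w p (1, 0) ∂(slabM n B))) := by
  refine (korn_limit hθ hv hw (1, 0) (0, a)).congr ?_
  intro k
  have hθv := (hθ.smooth k).mul hv.smooth
  have hs : HasCompactSupport (fun p => θ k p * v p) := (hθ.supp k).mul_right
  rw [korn_bilin B a (1, 0) 1 hθv hw.smooth hs, one_mul]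
  intro h
  rw [one_mul]
  apply korn_stokes_v hB
  · exact hθv.mul (hw.smooth.comp (by fun_prop))
  · exact hs.mul_right
  · intro x
    rcases h0 with h0 | h0
    · simp [h0]
    · simp [h0]

def kornDil (n : ℕ) : (ℝ × (Fin n → ℝ)) →L[ℝ] (ℝ × (Fin n → ℝ)) :=
  ((2 : ℝ) • ContinuousLinearMap.fst ℝ ℝ (Fin n → ℝ)).prod (ContinuousLinearMap.snd ℝ ℝ (Fin n → ℝ))

lemma kornDil_apply {n : ℕ} (y : ℝ) (x : Fin n → ℝ) : kornDil n (y, x) = (2 * y, x) := by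
  simp [kornDil]

lemma kornDil_mp {n : ℕ} (b : ℝ) :
    MeasurePreserving (kornDil n) (slabM n (b / 2)) (ENNReal.ofReal (1 / 2) • slabM n b) := by
  refine ⟨(kornDil n).continuous.measurable, ?_⟩
  have h1 : (kornDil n : ℝ × (Fin n → ℝ) → ℝ × (Fin n → ℝ)) = Prod.map (fun y => 2 * y) id := by
    ext p <;> simp [kornDil]
  have h2 : Measure.map (fun y : ℝ => 2 * y) (volume.restrict (Ioo (-(b / 2)) 0))
      = ENNReal.ofReal (1 / 2) • volume.restrict (Ioo (-b) 0) := by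
    have h3 : Ioo (-(b / 2)) 0 = (fun y : ℝ => 2 * y) ⁻¹' Ioo (-b) 0 := by
      ext y; simp only [mem_Ioo, mem_preimage]
      constructor <;> rintro ⟨h, h'⟩ <;> constructor <;> linarith
    rw [h3, ← Measure.restrict_map (by fun_prop) measurableSet_Ioo,
      Real.map_volume_mul_left two_ne_zero, Measure.restrict_smul]
    congr 2
    rw [abs_of_pos (by norm_num)]; norm_num
  rw [h1, ← Measure.map_prod_map _ _ (by fun_prop) measurable_id, h2, Measure.map_id,
    Measure.prod_smul_left]

lemma kornDil_memLp {n : ℕ} {b : ℝ} {f : ℝ × (Fin n → ℝ) → ℝ} (hf : MemLp f 2 (slabM n b)) :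
    MemLp (fun p => f (kornDil n p)) 2 (slabM n (b / 2)) :=
  (hf.smul_measure ENNReal.ofReal_ne_top).comp_measurePreserving (kornDil_mp b)

lemma kornDil_integral {n : ℕ} {b : ℝ} {f : ℝ × (Fin n → ℝ) → ℝ} (hf : Continuous f) :
    ∫ p, f (kornDil n p) ∂(slabM n (b / 2)) = 1 / 2 * ∫ p, f p ∂(slabM n b) := by
  have h := kornDil_mp (n := n) b
  have h2 := integral_map (μ := slabM n (b / 2)) h.measurable.aemeasurable (f := f) hf.aestronglyMeasurable
  rw [h.map_eq] at h2
  rw [← h2, integral_smul_measure, ENNReal.toReal_ofReal (by norm_num), smul_eq_mul]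

lemma korn_half_le {n : ℕ} {b : ℝ} (hb : 0 < b) : slabM n (b / 2) ≤ slabM n b :=
  Measure.prod_mono (Measure.restrict_mono (Ioo_subset_Ioo (by linarith) le_rfl) le_rfl) le_rfl

lemma kornDil_fderiv {n : ℕ} {v : ℝ × (Fin n → ℝ) → ℝ} (hv : ContDiff ℝ 1 v)
    (p e : ℝ × (Fin n → ℝ)) :
    fderiv ℝ (fun p => v (kornDil n p)) p e = fderiv ℝ v (kornDil n p) (kornDil n e) := by
  have h1 : HasFDerivAt v (fderiv ℝ v (kornDil n p)) (kornDil n p) :=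
    ((hv.differentiable one_ne_zero) _).hasFDerivAt
  have h2 : fderiv ℝ (fun p => v (kornDil n p)) p = _ := (h1.comp p (kornDil n).hasFDerivAt).fderiv
  rw [h2]; rfl

lemma KornL2.dil {n : ℕ} {b : ℝ} {v : ℝ × (Fin n → ℝ) → ℝ} (hv : KornL2 b v) :
    KornL2 (b / 2) (fun p => v (kornDil n p)) where
  smooth := hv.smooth.comp (kornDil n).contDiff
  zeroth := kornDil_memLp hv.zeroth
  first e := by
    simp only [kornDil_fderiv hv.smooth]
    exact kornDil_memLp (hv.first (kornDil n e))

lemma KornL2.half {n : ℕ} {b : ℝ} (hb : 0 < b) {v : ℝ × (Fin n → ℝ) → ℝ} (hv : KornL2 b v) :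
    KornL2 (b / 2) v where
  smooth := hv.smooth
  zeroth := hv.zeroth.mono_measure (korn_half_le hb)
  first e := (hv.first e).mono_measure (korn_half_le hb)

lemma korn_mixed {n : ℕ} {b : ℝ} (hb : 0 < b) {v w : ℝ × (Fin n → ℝ) → ℝ}
    (hv : KornL2 b v) (hw : KornL2 b w) (hv0 : ∀ x, v (-b, x) = 0) (hw0 : ∀ x, w (-b, x) = 0)
    (a : Fin n → ℝ) :
    ∫ p, (fderiv ℝ w p (0, a)) ^ 2 ∂(slabM n b) ≤
      28 * ∫ p, (fderiv ℝ w p (0, a) + fderiv ℝ v p (1, 0)) ^ 2 ∂(slabM n b)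
      + 10 * ∫ p, (fderiv ℝ v p (0, a)) ^ 2 ∂(slabM n b)
      + 10 * ∫ p, (fderiv ℝ w p (1, 0)) ^ 2 ∂(slabM n b) := by
  obtain ⟨θ, M, hθ⟩ := korn_cut_exists n
  have hbot : kornDil n (-(b / 2), 0) = (-b, 0) := by
    rw [kornDil_apply]; congr 1; ring
  have t1 := korn_V hb hθ hv hw (Or.inl hv0) a
  have t2 := korn_V (half_pos hb) hθ (hv.half hb) hw.dil
    (Or.inr fun x => by simp only [kornDil_apply]; rw [← hw0 x]; congr 2; ring) a
  have t3 := korn_V (half_pos hb) hθ hv.dil (hw.half hb)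
    (Or.inl fun x => by simp only [kornDil_apply]; rw [← hv0 x]; congr 2; ring) a
  have e10 : kornDil n (1, 0) = (2 : ℝ) • ((1 : ℝ), (0 : Fin n → ℝ)) := by
    rw [kornDil_apply]; ext <;> simp
  have e01 : kornDil n (0, a) = (0, a) := by rw [kornDil_apply]; simp
  have e0x : ∀ x, kornDil n (0, x) = (0, x) := fun x => by rw [kornDil_apply]; simp
  simp only [kornDil_fderiv hw.smooth, kornDil_fderiv hv.smooth, e10, e01, e0x, map_smul,
    smul_eq_mul] at t2 t3
  have i12 := tendsto_nhds_unique t1 t2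
  have i13 := tendsto_nhds_unique t1 t3
  clear t1 t2 t3
  -- abbreviations
  set P : ℝ × (Fin n → ℝ) → ℝ := fun p => fderiv ℝ w p (0, a) with hP
  set Q : ℝ × (Fin n → ℝ) → ℝ := fun p => fderiv ℝ v p (1, 0) with hQ
  set c : ℝ × (Fin n → ℝ) → ℝ := fun p => fderiv ℝ v p (0, a) with hc
  set A : ℝ × (Fin n → ℝ) → ℝ := fun p => fderiv ℝ w p (1, 0) with hA
  have mP : MemLp P 2 (slabM n b) := hw.first _
  have mQ : MemLp Q 2 (slabM n b) := hv.first _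
  have mc : MemLp c 2 (slabM n b) := hv.first _
  have mA : MemLp A 2 (slabM n b) := hw.first _
  have kP : Continuous P := korn_cont_dir hw.smooth _
  have kQ : Continuous Q := korn_cont_dir hv.smooth _
  have kc : Continuous c := korn_cont_dir hv.smooth _
  have kA : Continuous A := korn_cont_dir hw.smooth _
  set E : ℝ × (Fin n → ℝ) → ℝ := fun p => P p + Q p with hE
  have mE : MemLp E 2 (slabM n b) := mP.add mQ
  have kE : Continuous E := kP.add kQ
  change ∫ p, Q p * P p - c p * A p ∂(slabM n b)
    = ∫ p, Q p * P (kornDil n p) - c p * (2 * A (kornDil n p)) ∂(slabM n (b / 2)) at i12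
  change ∫ p, Q p * P p - c p * A p ∂(slabM n b)
    = ∫ p, 2 * Q (kornDil n p) * P p - c (kornDil n p) * A p ∂(slabM n (b / 2)) at i13
  change ∫ p, P p ^ 2 ∂(slabM n b) ≤ 28 * ∫ p, E p ^ 2 ∂(slabM n b)
    + 10 * ∫ p, c p ^ 2 ∂(slabM n b) + 10 * ∫ p, A p ^ 2 ∂(slabM n b)
  have sq : ∀ {B : ℝ} {f : ℝ × (Fin n → ℝ) → ℝ}, MemLp f 2 (slabM n B) →
      Integrable (fun p => f p ^ 2) (slabM n B) := fun h => h.integrable_sq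
  have hm : ∀ {f : ℝ × (Fin n → ℝ) → ℝ}, MemLp f 2 (slabM n b) → MemLp f 2 (slabM n (b / 2)) :=
    fun h => h.mono_measure (korn_half_le hb)
  have hmono : ∀ {f : ℝ × (Fin n → ℝ) → ℝ}, MemLp f 2 (slabM n b) →
      ∫ p, f p ^ 2 ∂(slabM n (b / 2)) ≤ ∫ p, f p ^ 2 ∂(slabM n b) := fun h =>
    integral_mono_measure (korn_half_le hb)
      (Filter.Eventually.of_forall fun p => sq_nonneg _) (sq h)
  -- integral over full slab
  have j1 : ∫ p, P p ^ 2 ∂(slabM n b) ≤ 2 * ∫ p, E p ^ 2 ∂(slabM n b)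
      + 1 / 8 * ∫ p, P p ^ 2 ∂(slabM n b) + 1 / 2 * ∫ p, c p ^ 2 ∂(slabM n b)
      + 1 / 2 * ∫ p, A p ^ 2 ∂(slabM n b) - ∫ p, Q p * P p - c p * A p ∂(slabM n b) := by
    rw [← integral_const_mul, ← integral_const_mul, ← integral_const_mul, ← integral_const_mul,
      ← integral_add, ← integral_add, ← integral_add, ← integral_sub]
    · apply integral_mono (sq mP)
      · exact (((((sq mE).const_mul _).add ((sq mP).const_mul _)).add ((sq mc).const_mul _)).add
          ((sq mA).const_mul _)).sub ((korn_int_mul mQ mP).sub (korn_int_mul mc mA))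
      · intro p
        simp only [hE]
        nlinarith [sq_nonneg (4 * (P p + Q p) - P p), sq_nonneg (c p + A p)]
    · exact (((((sq mE).const_mul _).add ((sq mP).const_mul _)).add ((sq mc).const_mul _)).add
          ((sq mA).const_mul _))
    · exact ((korn_int_mul mQ mP).sub (korn_int_mul mc mA))
    · exact ((((sq mE).const_mul _).add ((sq mP).const_mul _)).add ((sq mc).const_mul _))
    · exact ((sq mA).const_mul _)
    · exact (((sq mE).const_mul _).add ((sq mP).const_mul _))
    · exact ((sq mc).const_mul _)
    · exact ((sq mE).const_mul _)
    · exact ((sq mP).const_mul _)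
  -- half slab
  let δ := kornDil n
  have nQ := hm mQ
  have nP := hm mP
  have nc := hm mc
  have nA := hm mA
  have nE := hm mE
  have dQ := kornDil_memLp mQ
  have dP := kornDil_memLp mP
  have dc := kornDil_memLp mc
  have dA := kornDil_memLp mA
  have dE := kornDil_memLp mE
  have I2 : Integrable (fun p => Q p * P (kornDil n p) - c p * (2 * A (kornDil n p)))
      (slabM n (b / 2)) := (korn_int_mul nQ dP).sub (korn_int_mul nc (dA.const_mul 2))
  have I3 : Integrable (fun p => 2 * Q (kornDil n p) * P p - c (kornDil n p) * A p)
      (slabM n (b / 2)) := (korn_int_mul (dQ.const_mul 2) nP).sub (korn_int_mul dc nA)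
  have G1 : Integrable (fun p => 8 * E p ^ 2 + 1 / 8 * P (kornDil n p) ^ 2
      + 8 * E (kornDil n p) ^ 2 + 1 / 8 * P p ^ 2 + 2 * c p ^ 2 + 2 * A (kornDil n p) ^ 2
      + 1 / 2 * c (kornDil n p) ^ 2 + 1 / 2 * A p ^ 2) (slabM n (b / 2)) :=
    ((((((((sq nE).const_mul _).add ((sq dP).const_mul _)).add ((sq dE).const_mul _)).add
      ((sq nP).const_mul _)).add ((sq nc).const_mul _)).add ((sq dA).const_mul _)).add
      ((sq dc).const_mul _)).add ((sq nA).const_mul _)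
  have j2 : -(2 * (∫ p, Q p * P (kornDil n p) - c p * (2 * A (kornDil n p)) ∂(slabM n (b / 2)))
      - ∫ p, 2 * Q (kornDil n p) * P p - c (kornDil n p) * A p ∂(slabM n (b / 2)))
      ≤ ∫ p, (8 * E p ^ 2 + 1 / 8 * P (kornDil n p) ^ 2
      + 8 * E (kornDil n p) ^ 2 + 1 / 8 * P p ^ 2 + 2 * c p ^ 2 + 2 * A (kornDil n p) ^ 2
      + 1 / 2 * c (kornDil n p) ^ 2 + 1 / 2 * A p ^ 2) ∂(slabM n (b / 2)) := by
    rw [← integral_const_mul, ← integral_sub (I2.const_mul 2) I3, ← integral_neg]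
    apply integral_mono ((I2.const_mul 2).sub I3).neg G1
    intro p
    simp only [hE, Pi.neg_apply, Pi.sub_apply]
    nlinarith [sq_nonneg (8 * (P p + Q p) + P (kornDil n p)), sq_nonneg (c p - A (kornDil n p)),
      sq_nonneg (8 * (P (kornDil n p) + Q (kornDil n p)) - P p),
      sq_nonneg (c (kornDil n p) + A p)]
  have j3 : ∫ p, (8 * E p ^ 2 + 1 / 8 * P (kornDil n p) ^ 2
      + 8 * E (kornDil n p) ^ 2 + 1 / 8 * P p ^ 2 + 2 * c p ^ 2 + 2 * A (kornDil n p) ^ 2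
      + 1 / 2 * c (kornDil n p) ^ 2 + 1 / 2 * A p ^ 2) ∂(slabM n (b / 2))
      = 8 * (∫ p, E p ^ 2 ∂(slabM n (b / 2))) + 1 / 8 * (1 / 2 * ∫ p, P p ^ 2 ∂(slabM n b))
      + 8 * (1 / 2 * ∫ p, E p ^ 2 ∂(slabM n b)) + 1 / 8 * (∫ p, P p ^ 2 ∂(slabM n (b / 2)))
      + 2 * (∫ p, c p ^ 2 ∂(slabM n (b / 2))) + 2 * (1 / 2 * ∫ p, A p ^ 2 ∂(slabM n b))
      + 1 / 2 * (1 / 2 * ∫ p, c p ^ 2 ∂(slabM n b))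
      + 1 / 2 * (∫ p, A p ^ 2 ∂(slabM n (b / 2))) := by
    have s1 := (sq nE).const_mul 8
    have s2 := s1.add ((sq dP).const_mul (1 / 8))
    have s3 := s2.add ((sq dE).const_mul 8)
    have s4 := s3.add ((sq nP).const_mul (1 / 8))
    have s5 := s4.add ((sq nc).const_mul 2)
    have s6 := s5.add ((sq dA).const_mul 2)
    have s7 := s6.add ((sq dc).const_mul (1 / 2))
    have r7 := integral_add s7 ((sq nA).const_mul (1 / 2))
    have r6 := integral_add s6 ((sq dc).const_mul (1 / 2))
    have r5 := integral_add s5 ((sq dA).const_mul 2)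
    have r4 := integral_add s4 ((sq nc).const_mul 2)
    have r3 := integral_add s3 ((sq nP).const_mul (1 / 8))
    have r2 := integral_add s2 ((sq dE).const_mul 8)
    have r1 := integral_add s1 ((sq dP).const_mul (1 / 8))
    simp only [Pi.add_apply] at r1 r2 r3 r4 r5 r6 r7
    rw [r7, r6, r5, r4, r3, r2, r1]
    simp only [integral_const_mul]
    have hd : ∀ f : ℝ × (Fin n → ℝ) → ℝ, Continuous f →
        ∫ p, f (kornDil n p) ^ 2 ∂(slabM n (b / 2)) = 1 / 2 * ∫ p, f p ^ 2 ∂(slabM n b) :=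
      fun f hf => kornDil_integral (f := fun p => f p ^ 2) (hf.pow 2)
    rw [hd E kE, hd P kP, hd c kc, hd A kA]
  have q1 := hmono mE
  have q2 := hmono mP
  have q3 := hmono mc
  have q4 := hmono mA
  have z : ∀ f : ℝ × (Fin n → ℝ) → ℝ, 0 ≤ ∫ p, f p ^ 2 ∂(slabM n b) :=
    fun f => integral_nonneg fun p => sq_nonneg _
  have z1 := z E
  have z2 := z P
  have z3 := z c
  have z4 := z A
  linarith

lemma korn_poincare {n : ℕ} {b : ℝ} (hb : 0 < b) {w : ℝ × (Fin n → ℝ) → ℝ}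
    (hw : KornL2 b w) (hw0 : ∀ x, w (-b, x) = 0) :
    ∫ p, (w p) ^ 2 ∂(slabM n b) ≤ 4 * b ^ 2 * ∫ p, (fderiv ℝ w p (1, 0)) ^ 2 ∂(slabM n b) := by
  have i1 := hw.zeroth.integrable_sq
  have i2 := (hw.first (1, 0)).integrable_sq
  have k1 := hw.smooth.continuous
  have k2 := korn_cont_dir hw.smooth (1, 0)
  rw [← integral_const_mul, integral_prod_symm _ i1, integral_prod_symm _ (i2.const_mul _)]
  apply integral_mono i1.integral_prod_right (i2.const_mul _).integral_prod_right
  intro x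
  have hle : -b ≤ 0 := by linarith
  simp only
  rw [← integral_Ioc_eq_integral_Ioo, ← intervalIntegral.integral_of_le hle,
    ← integral_Ioc_eq_integral_Ioo, ← intervalIntegral.integral_of_le hle]
  have c1 : Continuous fun y : ℝ => w (y, x) := k1.comp (by fun_prop)
  have c2 : Continuous fun y : ℝ => fderiv ℝ w (y, x) (1, 0) := k2.comp (by fun_prop)
  have hd : ∀ y : ℝ, HasDerivAt (fun y => w (y, x)) (fderiv ℝ w (y, x) (1, 0)) y := by
    intro y
    have := korn_deriv_line hw.smooth (0, x) ((1 : ℝ), 0) y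
    simpa using this
  have ftc := intervalIntegral.integral_eq_sub_of_hasDerivAt (a := -b) (b := 0)
    (f := fun y => y * w (y, x) ^ 2)
    (f' := fun y => w (y, x) ^ 2 + y * (2 * w (y, x) * fderiv ℝ w (y, x) (1, 0)))
    (fun y _ => by
      have : HasDerivAt (fun y => y * w (y, x) ^ 2) _ y := (hasDerivAt_id y).mul ((hd y).pow 2)
      refine this.congr_deriv ?_
      simp)
    (by apply Continuous.intervalIntegrable; fun_prop)
  simp only [hw0] at ftc
  have hmono : ∫ y in (-b)..0, w (y, x) ^ 2 ≤ ∫ y in (-b)..0, (4 * b ^ 2 * fderiv ℝ w (y, x) (1, 0) ^ 2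
      + 2 * (w (y, x) ^ 2 + y * (2 * w (y, x) * fderiv ℝ w (y, x) (1, 0)))) := by
    apply intervalIntegral.integral_mono_on hle
    · apply Continuous.intervalIntegrable; fun_prop
    · apply Continuous.intervalIntegrable; fun_prop
    · intro y hy
      have hy2 : y ^ 2 ≤ b ^ 2 := by nlinarith [hy.1, hy.2]
      nlinarith [sq_nonneg (w (y, x) + 2 * y * fderiv ℝ w (y, x) (1, 0)),
        mul_le_mul_of_nonneg_right hy2 (sq_nonneg (fderiv ℝ w (y, x) (1, 0)))]
  rw [intervalIntegral.integral_add, intervalIntegral.integral_const_mul 2, ftc] at hmono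
  · simpa using hmono
  · apply Continuous.intervalIntegrable; fun_prop
  · apply Continuous.intervalIntegrable; fun_prop

def kornPhi (n : ℕ) : (ℝ × (Fin n → ℝ)) →L[ℝ] EuclideanSpace ℝ (Fin (n + 1)) :=
  ((PiLp.continuousLinearEquiv 2 ℝ (fun _ : Fin (n + 1) => ℝ)).symm :
    (Fin (n + 1) → ℝ) →L[ℝ] EuclideanSpace ℝ (Fin (n + 1))).comp
  (ContinuousLinearMap.pi (fun i : Fin (n + 1) =>
    Fin.lastCases (motive := fun _ => (ℝ × (Fin n → ℝ)) →L[ℝ] ℝ)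
      (ContinuousLinearMap.fst ℝ ℝ (Fin n → ℝ))
      (fun j => (ContinuousLinearMap.proj j).comp (ContinuousLinearMap.snd ℝ ℝ (Fin n → ℝ))) i))

lemma kornPhi_last {n : ℕ} (p : ℝ × (Fin n → ℝ)) : kornPhi n p (Fin.last n) = p.1 := by
  simp [kornPhi]

lemma kornPhi_castSucc {n : ℕ} (p : ℝ × (Fin n → ℝ)) (j : Fin n) :
    kornPhi n p j.castSucc = p.2 j := by
  simp [kornPhi]

lemma kornPhi_e_last (n : ℕ) : kornPhi n (1, 0) = EuclideanSpace.single (Fin.last n) 1 := by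
  ext i
  refine Fin.lastCases ?_ (fun j => ?_) i
  · rw [kornPhi_last]; simp
  · rw [kornPhi_castSucc]; simp [Fin.castSucc_ne_last]

lemma kornPhi_e_cast {n : ℕ} (k : Fin n) :
    kornPhi n (0, Pi.single k 1) = EuclideanSpace.single k.castSucc 1 := by
  ext i
  refine Fin.lastCases ?_ (fun j => ?_) i
  · rw [kornPhi_last]; simp [(Fin.castSucc_ne_last k).symm]
  · rw [kornPhi_castSucc]; simp [Pi.single_apply]

lemma kornPhi_mp (n : ℕ) : MeasurePreserving (kornPhi n) volume volume := by
  have h := (PiLp.volume_preserving_toLp (Fin (n + 1))).comp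
    ((volume_preserving_piFinSuccAbove (fun _ : Fin (n + 1) => ℝ) (Fin.last n)).symm)
  have hf : (kornPhi n : ℝ × (Fin n → ℝ) → EuclideanSpace ℝ (Fin (n + 1))) = WithLp.toLp 2 ∘
      (MeasurableEquiv.piFinSuccAbove (fun _ : Fin (n + 1) => ℝ) (Fin.last n)).symm := by
    funext p
    ext i
    refine Fin.lastCases ?_ (fun j => ?_) i
    · rw [kornPhi_last]; simp [MeasurableEquiv.piFinSuccAbove, Fin.insertNthEquiv]
    · rw [kornPhi_castSucc]; simp [MeasurableEquiv.piFinSuccAbove, Fin.insertNthEquiv]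
  rw [hf]
  exact h

lemma kornPhi_emb (n : ℕ) : MeasurableEmbedding (kornPhi n) := by
  apply (kornPhi n).continuous.measurableEmbedding
  intro p q h
  ext j
  · rw [← kornPhi_last p, ← kornPhi_last q, h]
  · rw [← kornPhi_castSucc p, ← kornPhi_castSucc q, h]

lemma kornPhi_slab (n : ℕ) (b : ℝ) : MeasurePreserving (kornPhi n) (slabM n b)
    (volume.restrict {y : EuclideanSpace ℝ (Fin (n + 1)) | y (Fin.last n) ∈ Ioo (-b) 0}) := by
  have hm : MeasurableSet {y : EuclideanSpace ℝ (Fin (n + 1)) | y (Fin.last n) ∈ Ioo (-b) 0} := by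
    apply measurableSet_Ioo.preimage
    exact (EuclideanSpace.proj (𝕜 := ℝ) (Fin.last n)).continuous.measurable
  have h := (kornPhi_mp n).restrict_preimage hm
  have : (kornPhi n) ⁻¹' {y : EuclideanSpace ℝ (Fin (n + 1)) | y (Fin.last n) ∈ Ioo (-b) 0}
      = Ioo (-b) 0 ×ˢ univ := by
    ext p
    simp only [mem_preimage, Set.mem_ofPred_eq, kornPhi_last, mem_prod, mem_univ, and_true]
  rw [this, Measure.volume_eq_prod, ← Measure.prod_restrict, Measure.restrict_univ] at h
  exact h

lemma korn_opNorm {m : ℕ} (L : EuclideanSpace ℝ (Fin m) →L[ℝ] EuclideanSpace ℝ (Fin m)) :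
    ‖L‖ ^ 2 ≤ ∑ k, ∑ j, (L (EuclideanSpace.single k 1) j) ^ 2 := by
  have h1 : ∀ k, ∑ j, (L (EuclideanSpace.single k 1) j) ^ 2 = ‖L (EuclideanSpace.single k 1)‖ ^ 2 := by
    intro k
    rw [EuclideanSpace.norm_sq_eq]; simp
  simp only [h1]
  have h2 : ‖L‖ ≤ Real.sqrt (∑ k, ‖L (EuclideanSpace.single k 1)‖ ^ 2) := by
    refine L.opNorm_le_bound (Real.sqrt_nonneg _) fun x => ?_
    have hx : x = ∑ k, x k • EuclideanSpace.single k (1 : ℝ) := by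
      ext i
      simp [Finset.sum_apply, Pi.single_apply]
    have h3 : ‖L x‖ ≤ ∑ k, ‖L (EuclideanSpace.single k 1)‖ * ‖x k‖ := by
      conv_lhs => rw [hx]
      rw [map_sum]
      refine (norm_sum_le _ _).trans (le_of_eq ?_)
      congr 1; ext k
      rw [map_smul, norm_smul, mul_comm]
    refine h3.trans ((Real.sum_mul_le_sqrt_mul_sqrt _ _ _).trans (le_of_eq ?_))
    rw [EuclideanSpace.norm_eq x]
  calc ‖L‖ ^ 2 ≤ (Real.sqrt (∑ k, ‖L (EuclideanSpace.single k 1)‖ ^ 2)) ^ 2 :=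
        pow_le_pow_left₀ (norm_nonneg _) h2 2
    _ = _ := Real.sq_sqrt (Finset.sum_nonneg fun k _ => sq_nonneg _)

lemma korn_succ (n : ℕ) (b : ℝ) (hb : 0 < b) :
    ∃ C > 0, ∀ u : EuclideanSpace ℝ (Fin (n + 1)) → EuclideanSpace ℝ (Fin (n + 1)),
      ContDiff ℝ 1 u →
      (∀ x : EuclideanSpace ℝ (Fin (n + 1)), x (Fin.last n) = -b → u x = 0) →
      (∫ x in {y : EuclideanSpace ℝ (Fin (n + 1)) | y (Fin.last n) ∈ Set.Ioo (-b) 0},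
          ‖u x‖ ^ 2 + ‖fderiv ℝ u x‖ ^ 2)
        ≤ C * ∫ x in {y : EuclideanSpace ℝ (Fin (n + 1)) | y (Fin.last n) ∈ Set.Ioo (-b) 0},
            ∑ i : Fin (n + 1), ∑ j : Fin (n + 1),
              (fderiv ℝ u x (EuclideanSpace.single i 1) j
                + fderiv ℝ u x (EuclideanSpace.single j 1) i) ^ 2 := by
  refine ⟨((n : ℝ) + 1) * (4 * b ^ 2 * 68) + ((n : ℝ) + 1) * (((n : ℝ) + 1) * 68), by positivity, ?_⟩
  intro u hu hu0
  rw [← (kornPhi_slab n b).integral_comp (kornPhi_emb n),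
    ← (kornPhi_slab n b).integral_comp (kornPhi_emb n)]
  have hSnn : ∀ p, 0 ≤ ∑ i : Fin (n + 1), ∑ j : Fin (n + 1),
              (fderiv ℝ u (kornPhi n p) (EuclideanSpace.single i 1) j
                + fderiv ℝ u (kornPhi n p) (EuclideanSpace.single j 1) i) ^ 2 := fun p =>
    Finset.sum_nonneg fun i _ => Finset.sum_nonneg fun j _ => sq_nonneg _
  by_cases hInt : Integrable (fun p => ‖u (kornPhi n p)‖ ^ 2 + ‖fderiv ℝ u (kornPhi n p)‖ ^ 2)
      (slabM n b)
  swap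
  · rw [integral_undef hInt]
    exact mul_nonneg (by positivity) (integral_nonneg hSnn)
  set U : Fin (n + 1) → ℝ × (Fin n → ℝ) → ℝ := fun j p => u (kornPhi n p) j with hU
  set D : Fin (n + 1) → Fin (n + 1) → ℝ × (Fin n → ℝ) → ℝ := fun k j p =>
    fderiv ℝ u (kornPhi n p) (EuclideanSpace.single k 1) j with hD
  have hUs : ∀ j, ContDiff ℝ 1 (U j) := fun j =>
    (EuclideanSpace.proj (𝕜 := ℝ) j).contDiff.comp (hu.comp (kornPhi n).contDiff)
  have hUd : ∀ j p e, fderiv ℝ (U j) p e = fderiv ℝ u (kornPhi n p) (kornPhi n e) j := by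
    intro j p e
    have h1 : HasFDerivAt u (fderiv ℝ u (kornPhi n p)) (kornPhi n p) :=
      ((hu.differentiable one_ne_zero) _).hasFDerivAt
    have h2 := h1.comp p (kornPhi n).hasFDerivAt
    have h3 := (EuclideanSpace.proj (𝕜 := ℝ) j).hasFDerivAt.comp p h2
    have h4 : fderiv ℝ (U j) p = _ := h3.fderiv
    rw [h4]; rfl
  have hUL : ∀ j p, fderiv ℝ (U j) p (1, 0) = D (Fin.last n) j p := by
    intro j p; rw [hUd, kornPhi_e_last]
  have hUC : ∀ j k p, fderiv ℝ (U j) p (0, Pi.single k 1) = D k.castSucc j p := by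
    intro j k p; rw [hUd, kornPhi_e_cast]
  have hcoord : ∀ (z : EuclideanSpace ℝ (Fin (n + 1))) j, (z j) ^ 2 ≤ ‖z‖ ^ 2 := by
    intro z j
    rw [← sq_abs, ← Real.norm_eq_abs]
    exact pow_le_pow_left₀ (norm_nonneg _) (PiLp.norm_apply_le z j) 2
  have hL2 : ∀ j, KornL2 b (U j) := by
    intro j
    refine ⟨hUs j, ?_, fun e => ?_⟩
    · rw [memLp_two_iff_integrable_sq (hUs j).continuous.aestronglyMeasurable]
      refine hInt.mono' ((hUs j).continuous.pow 2).aestronglyMeasurable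
        (Filter.Eventually.of_forall fun p => ?_)
      rw [Real.norm_of_nonneg (sq_nonneg _)]
      have := hcoord (u (kornPhi n p)) j
      exact this.trans (le_add_of_nonneg_right (sq_nonneg _))
    · have hc := korn_cont_dir (hUs j) e
      rw [memLp_two_iff_integrable_sq hc.aestronglyMeasurable]
      refine (hInt.mul_const (‖kornPhi n e‖ ^ 2)).mono' (hc.pow 2).aestronglyMeasurable
        (Filter.Eventually.of_forall fun p => ?_)
      rw [Real.norm_of_nonneg (sq_nonneg _), hUd]
      refine (hcoord _ j).trans ?_
      have h1 := pow_le_pow_left₀ (norm_nonneg _)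
        ((fderiv ℝ u (kornPhi n p)).le_opNorm (kornPhi n e)) 2
      rw [mul_pow] at h1
      refine h1.trans (mul_le_mul_of_nonneg_right ?_ (sq_nonneg _))
      exact le_add_of_nonneg_left (sq_nonneg _)
  have hU0 : ∀ j x, U j (-b, x) = 0 := by
    intro j x
    simp only [hU]
    rw [hu0 _ (by rw [kornPhi_last])]; simp
  have mD : ∀ k j, MemLp (D k j) 2 (slabM n b) := by
    intro k j
    refine Fin.lastCases ?_ (fun i => ?_) k
    · have := (hL2 j).first (1, 0)
      simpa only [hUL] using this
    · have := (hL2 j).first (0, Pi.single i 1)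
      simpa only [hUC] using this
  have sD : ∀ k j, Integrable (fun p => D k j p ^ 2) (slabM n b) := fun k j => (mD k j).integrable_sq
  have sS : ∀ i j, Integrable (fun p => (D i j p + D j i p) ^ 2) (slabM n b) := fun i j =>
    ((mD i j).add (mD j i)).integrable_sq
  change ∫ p, ‖u (kornPhi n p)‖ ^ 2 + ‖fderiv ℝ u (kornPhi n p)‖ ^ 2 ∂(slabM n b) ≤ _ *
    ∫ p, ∑ i, ∑ j, (D i j p + D j i p) ^ 2 ∂(slabM n b)
  set I := ∫ p, ∑ i, ∑ j, (D i j p + D j i p) ^ 2 ∂(slabM n b) with hI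
  have hs : ∀ i j, ∫ p, (D i j p + D j i p) ^ 2 ∂(slabM n b) ≤ I := by
    intro i j
    apply integral_mono (sS i j)
    · exact integrable_finsetSum _ fun i _ => integrable_finsetSum _ fun j _ => sS i j
    · intro p
      refine le_trans ?_ (Finset.single_le_sum (f := fun i => ∑ j, (D i j p + D j i p) ^ 2)
        (fun i _ => Finset.sum_nonneg fun j _ => sq_nonneg _) (Finset.mem_univ i))
      exact Finset.single_le_sum (f := fun j => (D i j p + D j i p) ^ 2)
        (fun j _ => sq_nonneg _) (Finset.mem_univ j)
  have hI0 : 0 ≤ I := integral_nonneg hSnn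
  have diag : ∀ j, ∫ p, D j j p ^ 2 ∂(slabM n b) ≤ 1 / 4 * I := by
    intro j
    have h1 := hs j j
    have h2 : ∫ p, (D j j p + D j j p) ^ 2 ∂(slabM n b) = 4 * ∫ p, D j j p ^ 2 ∂(slabM n b) := by
      rw [← integral_const_mul]; congr 1; ext p; ring
    linarith
  have mix1 : ∀ i : Fin n, ∫ p, D i.castSucc (Fin.last n) p ^ 2 ∂(slabM n b) ≤ 33 * I := by
    intro i
    have h := korn_mixed hb (hL2 i.castSucc) (hL2 (Fin.last n)) (hU0 _) (hU0 _) (Pi.single i 1)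
    simp only [hUL, hUC] at h
    linarith [hs i.castSucc (Fin.last n), diag i.castSucc, diag (Fin.last n)]
  have mix2 : ∀ i : Fin n, ∫ p, D (Fin.last n) i.castSucc p ^ 2 ∂(slabM n b) ≤ 68 * I := by
    intro i
    have h : ∫ p, D (Fin.last n) i.castSucc p ^ 2 ∂(slabM n b) ≤
        ∫ p, (2 * D i.castSucc (Fin.last n) p ^ 2
          + 2 * (D i.castSucc (Fin.last n) p + D (Fin.last n) i.castSucc p) ^ 2) ∂(slabM n b) := by
      apply integral_mono (sD _ _) (((sD _ _).const_mul _).add ((sS _ _).const_mul _))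
      intro p
      simp only [Pi.add_apply]
      nlinarith [sq_nonneg (2 * D i.castSucc (Fin.last n) p + D (Fin.last n) i.castSucc p)]
    rw [integral_add ((sD _ _).const_mul _) ((sS _ _).const_mul _), integral_const_mul,
      integral_const_mul] at h
    linarith [hs i.castSucc (Fin.last n), mix1 i]
  have hor : ∀ i j : Fin n, ∫ p, D i.castSucc j.castSucc p ^ 2 ∂(slabM n b) ≤ 2 * I := by
    intro i j
    have hz := korn_H (hL2 i.castSucc) (hL2 j.castSucc) (Pi.single i 1) (Pi.single j 1)
    simp only [hUC] at hz
    have iz : Integrable (fun p => D j.castSucc i.castSucc p * D i.castSucc j.castSucc p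
        - D i.castSucc i.castSucc p * D j.castSucc j.castSucc p) (slabM n b) :=
      (korn_int_mul (mD _ _) (mD _ _)).sub (korn_int_mul (mD _ _) (mD _ _))
    have h : ∫ p, D i.castSucc j.castSucc p ^ 2 ∂(slabM n b) ≤
        ∫ p, (D i.castSucc j.castSucc p + D j.castSucc i.castSucc p) ^ 2 ∂(slabM n b)
        + ∫ p, D i.castSucc i.castSucc p ^ 2 ∂(slabM n b)
        + ∫ p, D j.castSucc j.castSucc p ^ 2 ∂(slabM n b)
        - 2 * ∫ p, D j.castSucc i.castSucc p * D i.castSucc j.castSucc p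
        - D i.castSucc i.castSucc p * D j.castSucc j.castSucc p ∂(slabM n b) := by
      have a1 : Integrable (fun p => (D i.castSucc j.castSucc p + D j.castSucc i.castSucc p) ^ 2
          + D i.castSucc i.castSucc p ^ 2) (slabM n b) := (sS _ _).add (sD _ _)
      have a2 : Integrable (fun p => (D i.castSucc j.castSucc p + D j.castSucc i.castSucc p) ^ 2
          + D i.castSucc i.castSucc p ^ 2 + D j.castSucc j.castSucc p ^ 2) (slabM n b) := a1.add (sD j.castSucc j.castSucc)
      rw [← integral_const_mul, ← integral_add (sS _ _) (sD _ _), ← integral_add a1 (sD _ _),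
        ← integral_sub a2 (iz.const_mul 2)]
      apply integral_mono (sD _ _) (a2.sub (iz.const_mul 2))
      intro p
      simp only [Pi.sub_apply]
      nlinarith [sq_nonneg (D i.castSucc i.castSucc p + D j.castSucc j.castSucc p),
        sq_nonneg (D j.castSucc i.castSucc p)]
    rw [hz] at h
    linarith [hs i.castSucc j.castSucc, diag i.castSucc, diag j.castSucc]
  have all : ∀ k j, ∫ p, D k j p ^ 2 ∂(slabM n b) ≤ 68 * I := by
    intro k j
    refine Fin.lastCases ?_ (fun k' => ?_) k
    · refine Fin.lastCases ?_ (fun j' => ?_) j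
      · linarith [diag (Fin.last n)]
      · exact mix2 j'
    · refine Fin.lastCases ?_ (fun j' => ?_) j
      · linarith [mix1 k']
      · linarith [hor k' j']
  have poin : ∀ j, ∫ p, U j p ^ 2 ∂(slabM n b) ≤ 4 * b ^ 2 * 68 * I := by
    intro j
    have h := korn_poincare hb (hL2 j) (hU0 j)
    simp only [hUL] at h
    refine h.trans ?_
    rw [mul_assoc (4 * b ^ 2)]
    exact mul_le_mul_of_nonneg_left (all _ _) (by positivity)
  have sU : ∀ j, Integrable (fun p => U j p ^ 2) (slabM n b) := fun j => (hL2 j).zeroth.integrable_sq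
  have iU := integrable_finsetSum Finset.univ fun j (_ : j ∈ Finset.univ) => sU j
  have iD := integrable_finsetSum Finset.univ fun k (_ : k ∈ Finset.univ) =>
    integrable_finsetSum Finset.univ fun j (_ : j ∈ Finset.univ) => sD k j
  calc ∫ p, ‖u (kornPhi n p)‖ ^ 2 + ‖fderiv ℝ u (kornPhi n p)‖ ^ 2 ∂(slabM n b)
      ≤ ∫ p, (∑ j, U j p ^ 2) + ∑ k, ∑ j, D k j p ^ 2 ∂(slabM n b) := by
        apply integral_mono hInt (iU.add iD)
        intro p
        refine add_le_add (le_of_eq ?_) (korn_opNorm _)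
        rw [EuclideanSpace.norm_sq_eq]; simp [hU]
    _ = (∑ j, ∫ p, U j p ^ 2 ∂(slabM n b)) + ∑ k, ∑ j, ∫ p, D k j p ^ 2 ∂(slabM n b) := by
        rw [integral_add iU iD, integral_finsetSum _ fun j _ => sU j,
          integral_finsetSum _ fun k _ => integrable_finsetSum _ fun j _ => sD k j]
        congr 1
        refine Finset.sum_congr rfl fun k _ => ?_
        rw [integral_finsetSum _ fun j _ => sD k j]
    _ ≤ (∑ _j : Fin (n + 1), 4 * b ^ 2 * 68 * I) + ∑ _k : Fin (n + 1), ∑ _j : Fin (n + 1), 68 * I :=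
        add_le_add (Finset.sum_le_sum fun j _ => poin j)
          (Finset.sum_le_sum fun k _ => Finset.sum_le_sum fun j _ => all k j)
    _ = _ := by
        simp only [Finset.sum_const, Finset.card_univ, Fintype.card_fin, nsmul_eq_mul]
        push_cast
        ring

end

/-- Korn's inequality on the slab `Ω = ℝ^{d-1} × (-b,0) ⊆ ℝ^d` with Dirichlet condition
on the bottom boundary `Σ_b = {x_d = -b}`:  `‖u‖_{H¹(Ω)} ≲ ‖𝔻u‖_{L²(Ω)}`, where
`(𝔻u)_{ij} = ∂_i u_j + ∂_j u_i` is the symmetric gradient. -/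
theorem korn_slab (d : ℕ) (hd : 1 ≤ d) (b : ℝ) (hb : 0 < b) :
    ∃ C > 0, ∀ u : EuclideanSpace ℝ (Fin d) → EuclideanSpace ℝ (Fin d),
      ContDiff ℝ 1 u →
      (∀ x : EuclideanSpace ℝ (Fin d), x ⟨d - 1, by omega⟩ = -b → u x = 0) →
      (∫ x in {y : EuclideanSpace ℝ (Fin d) | y ⟨d - 1, by omega⟩ ∈ Set.Ioo (-b) 0},
          ‖u x‖ ^ 2 + ‖fderiv ℝ u x‖ ^ 2)
        ≤ C * ∫ x in {y : EuclideanSpace ℝ (Fin d) | y ⟨d - 1, by omega⟩ ∈ Set.Ioo (-b) 0},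
            ∑ i : Fin d, ∑ j : Fin d,
              (fderiv ℝ u x (EuclideanSpace.single i 1) j
                + fderiv ℝ u x (EuclideanSpace.single j 1) i) ^ 2 := by
  obtain ⟨n, rfl⟩ : ∃ n, d = n + 1 := ⟨d - 1, by omega⟩
  exact korn_succ n b hb
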